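/- Let m be a universal semimeasure and let m(·|·) be a universal conditional semimeasure. For every upper semicomputable sumtest e for m there exists a constant c > 0 such that for all bitstrings x: e(x) · m(x) ≤ c · liminf_{t→∞} m(x|t). (Since liminf_{t→∞} m(x|t) = Θ(2^{−K^{∅'}(x)}) and m(x) = Θ(2^{−K(x)}), this expresses that log e(x) ≤ K(x) − K^{∅'}(x) + O(1), i.e. log e(x) is bounded by the mutual information of x with the Halting problem.) -/

import Mathlib

open scoped ENNReal NNReal

/-- Interpret a rational approximation value as an extended nonnegative real. -/
noncomputable def qval (q : ℚ) : ℝ≥0∞ := ENNReal.ofReal q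

/-- Interpret a value in `ℚ≥0 ∪ {∞}` (with nonnegativity required separately)
as an extended nonnegative real; `none` stands for `∞`. -/
noncomputable def qtval (q : Option ℚ) : ℝ≥0∞ := q.elim ⊤ (fun a => ENNReal.ofReal a)

/-- A (discrete) semimeasure on bitstrings. -/
def IsSemimeasure (P : List Bool → ℝ≥0∞) : Prop := ∑' x, P x ≤ 1

/-- `Ps` is a computable approximation of `P` from below (by nonnegative rationals,
nondecreasing in the stage). -/
def IsApproxFromBelow (P : List Bool → ℝ≥0∞) (Ps : List Bool → ℕ → ℚ) : Prop :=
  Computable (fun p : List Bool × ℕ => Ps p.1 p.2) ∧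
  (∀ x s, 0 ≤ Ps x s) ∧
  (∀ x, Monotone fun s => Ps x s) ∧
  (∀ x, P x = ⨆ s, qval (Ps x s))

/-- `P` is lower semicomputable. -/
def LowerSemicomputable (P : List Bool → ℝ≥0∞) : Prop := ∃ Ps, IsApproxFromBelow P Ps

/-- `es` is a computable approximation of `e` from above (by values in `ℚ≥0 ∪ {∞}`,
nonincreasing in the stage). -/
def IsApproxFromAbove (e : List Bool → ℝ≥0∞) (es : List Bool → ℕ → Option ℚ) : Prop :=
  Computable (fun p : List Bool × ℕ => es p.1 p.2) ∧
  (∀ x s, ∀ a ∈ es x s, (0:ℚ) ≤ a) ∧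
  (∀ x, Antitone fun s => qtval (es x s)) ∧
  (∀ x, e x = ⨅ s, qtval (es x s))

/-- `e` is upper semicomputable. -/
def UpperSemicomputable (e : List Bool → ℝ≥0∞) : Prop := ∃ es, IsApproxFromAbove e es

/-- `e` is a sumtest for the semimeasure `P`. -/
def IsSumtest (P e : List Bool → ℝ≥0∞) : Prop := ∑' x, P x * e x ≤ 1

/-- `m` is a universal (lower semicomputable) semimeasure. -/
def IsUniversalSemimeasure (m : List Bool → ℝ≥0∞) : Prop :=
  IsSemimeasure m ∧ LowerSemicomputable m ∧
  ∀ P, IsSemimeasure P → LowerSemicomputable P → ∃ c : ℝ≥0, 0 < c ∧ ∀ x, P x ≤ c * m x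

/-- A conditional semimeasure `m(·|·)`. -/
def IsCondSemimeasure (m : List Bool → ℕ → ℝ≥0∞) : Prop := ∀ s, ∑' x, m x s ≤ 1

/-- `ms` is a computable approximation from below of the conditional semimeasure `m`:
`ms t x s` approximates `m(x|s)`, nondecreasing in the stage `t`. -/
def IsCondApproxFromBelow (m : List Bool → ℕ → ℝ≥0∞) (ms : ℕ → List Bool → ℕ → ℚ) : Prop :=
  Computable (fun p : ℕ × List Bool × ℕ => ms p.1 p.2.1 p.2.2) ∧
  (∀ t x s, 0 ≤ ms t x s) ∧
  (∀ x s, Monotone fun t => ms t x s) ∧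
  (∀ x s, m x s = ⨆ t, qval (ms t x s))

/-- The conditional semimeasure `m` is lower semicomputable (jointly). -/
def CondLowerSemicomputable (m : List Bool → ℕ → ℝ≥0∞) : Prop :=
  ∃ ms, IsCondApproxFromBelow m ms

/-- `m(·|·)` is a universal lower semicomputable conditional semimeasure. -/
def IsUniversalCondSemimeasure (m : List Bool → ℕ → ℝ≥0∞) : Prop :=
  IsCondSemimeasure m ∧ CondLowerSemicomputable m ∧
  ∀ m', IsCondSemimeasure m' → CondLowerSemicomputable m' →
    ∃ c : ℝ≥0, 0 < c ∧ ∀ x s, m' x s ≤ c * m x s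

open Encodable

namespace Computable

/-- A function into a denumerable type is computable if its graph is decidable. -/
theorem of_graph {α β : Type*} [Primcodable α] [Denumerable β] {f : α → β} {p : α → β → Bool}
    (hp : Computable₂ p) (h : ∀ a b, p a b = true ↔ b = f a) : Computable f := by
  have hs : Computable₂ fun (a : α) (n : ℕ) => p a (Denumerable.ofNat β n) :=
    hp.comp Computable.fst ((Computable.ofNat β).comp Computable.snd)
  refine Computable.encode_iff.1 ((Partrec.rfind hs.partrec₂).of_eq_tot fun a => ?_)
  refine Nat.mem_rfind.2 ⟨?_, fun {k} hk => ?_⟩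
  · simp [(h a _).2]
  · have : p a (Denumerable.ofNat β k) = false := by
      rw [Bool.eq_false_iff, Ne, h]
      rintro hk'
      rw [← hk', Denumerable.encode_ofNat] at hk
      exact hk.false
    simp [this]

end Computable

/-- The codes of the rationals under their structural encoding, as a decidable set:
pairs of an integer code and a positive denominator coprime to it. -/
def IsRatCode (k : ℕ) : Prop := 0 < k.unpair.2 ∧ ((k.unpair.1 + 1) / 2).Coprime k.unpair.2

instance : DecidablePred IsRatCode := fun _ => inferInstanceAs (Decidable (_ ∧ _))

/-- The structural code of a rational. -/
def ratCode (q : ℚ) : ℕ := Nat.pair (encode q.num) q.den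

theorem Int.encode_succ_div_two (z : ℤ) : (encode z + 1) / 2 = z.natAbs := by
  cases z with
  | ofNat n => change (2 * n + 1) / 2 = n; omega
  | negSucc n => change (2 * n + 1 + 1) / 2 = n + 1; omega

theorem Int.encode_mod_two (z : ℤ) : encode z % 2 = 0 ↔ 0 ≤ z := by
  cases z with
  | ofNat n => change (2 * n) % 2 = 0 ↔ _; simp
  | negSucc n =>
    change (2 * n + 1) % 2 = 0 ↔ _
    have := Int.negSucc_lt_zero n
    omega

theorem Int.exists_encode_eq (n : ℕ) : ∃ z : ℤ, encode z = n := by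
  rcases Nat.even_or_odd' n with ⟨k, rfl | rfl⟩
  · exact ⟨(k : ℤ), rfl⟩
  · exact ⟨Int.negSucc k, rfl⟩

theorem isRatCode_iff (k : ℕ) : IsRatCode k ↔ ∃ q, ratCode q = k := by
  constructor
  · rintro ⟨h0, hc⟩
    obtain ⟨z, hz⟩ := Int.exists_encode_eq k.unpair.1
    rw [← hz, Int.encode_succ_div_two] at hc
    exact ⟨⟨z, k.unpair.2, h0.ne', hc⟩, by simp [ratCode, hz]⟩
  · rintro ⟨q, rfl⟩
    simpa [IsRatCode, ratCode, Int.encode_succ_div_two, q.den_pos] using q.reduced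

theorem encode_rat_eq (q : ℚ) :
    @encode ℚ Primcodable.toEncodable q =
      ((List.range (ratCode q)).filter (fun k => IsRatCode k)).length := by
  rw [← List.countP_eq_length_filter]
  change (List.range (ratCode q)).countP (fun k => @decide
    (k ∈ Set.range (@encode ℚ Rat.instEncodable)) (@decidableRangeEncode ℚ _ k)) = _
  congr 1
  funext k
  exact decide_eq_decide.2 (isRatCode_iff k).symm

theorem primrecPred_isRatCode : PrimrecPred IsRatCode := by
  have hR : PrimrecRel fun d k : ℕ =>
      d ≤ 1 ∨ ¬ ((k.unpair.1 + 1) / 2 % d = 0) ∨ ¬ (k.unpair.2 % d = 0) := by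
    have h1 : Primrec fun p : ℕ × ℕ => (p.2.unpair.1 + 1) / 2 :=
      Primrec.nat_div.comp (Primrec.succ.comp
        (Primrec.fst.comp (Primrec.unpair.comp Primrec.snd))) (Primrec.const 2)
    have h2 : Primrec fun p : ℕ × ℕ => p.2.unpair.2 :=
      Primrec.snd.comp (Primrec.unpair.comp Primrec.snd)
    exact (Primrec.nat_le.comp Primrec.fst (Primrec.const 1)).or
      ((Primrec.eq.comp (Primrec.nat_mod.comp h1 Primrec.fst) (Primrec.const 0)).not.or
        (Primrec.eq.comp (Primrec.nat_mod.comp h2 Primrec.fst) (Primrec.const 0)).not)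
  have hd : Primrec fun k : ℕ => k.unpair.2 := Primrec.snd.comp Primrec.unpair
  refine ((Primrec.nat_lt.comp (Primrec.const 0) hd).and
    (hR.forall_lt.comp (Primrec.succ.comp hd) Primrec.id)).of_eq fun k => ?_
  refine and_congr_right fun h0 => ⟨fun h => ?_, fun h d _ => ?_⟩
  · have hg := h (Nat.gcd ((k.unpair.1 + 1) / 2) k.unpair.2)
      (Nat.lt_succ_of_le (Nat.gcd_le_right _ h0))
    rcases hg with hg | hg | hg
    · have := Nat.gcd_pos_of_pos_right ((k.unpair.1 + 1) / 2) h0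
      exact le_antisymm hg this
    · exact (hg (Nat.mod_eq_zero_of_dvd (Nat.gcd_dvd_left _ _))).elim
    · exact (hg (Nat.mod_eq_zero_of_dvd (Nat.gcd_dvd_right _ _))).elim
  · by_contra! hc
    rw [id] at hc
    have := Nat.dvd_gcd (Nat.dvd_of_mod_eq_zero hc.2.1) (Nat.dvd_of_mod_eq_zero hc.2.2)
    rw [show Nat.gcd _ _ = 1 from h] at this
    exact (Nat.le_of_dvd one_pos this).not_gt hc.1

theorem computable_ratCode : Computable ratCode := by
  have hc : Primrec fun k : ℕ => ((List.range k).filter (fun j => IsRatCode j)).length :=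
    Primrec.list_length.comp ((Primrec.listFilter primrecPred_isRatCode).comp Primrec.list_range)
  have hp : PrimrecRel fun (q : ℚ) (k : ℕ) =>
      IsRatCode k ∧ ((List.range k).filter (fun j => IsRatCode j)).length =
        @encode ℚ Primcodable.toEncodable q :=
    (primrecPred_isRatCode.comp Primrec.snd).and
      (Primrec.eq.comp (hc.comp Primrec.snd) (Primrec.encode.comp Primrec.fst))
  refine Computable.of_graph (p := fun q k => decide (IsRatCode k ∧
    ((List.range k).filter (fun j => IsRatCode j)).length =
        @encode ℚ Primcodable.toEncodable q)) hp.decide.to_comp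
    fun q k => ?_
  rw [decide_eq_true_iff, isRatCode_iff]
  constructor
  · rintro ⟨⟨r, rfl⟩, h⟩
    rw [← encode_rat_eq] at h
    rw [@encode_injective ℚ Primcodable.toEncodable _ _ h]
  · rintro rfl
    exact ⟨⟨q, rfl⟩, (encode_rat_eq q).symm⟩

theorem Rat.computable_natAbs_num : Computable fun q : ℚ => q.num.natAbs := by
  have : Primrec fun k : ℕ => (k.unpair.1 + 1) / 2 :=
    Primrec.nat_div.comp (Primrec.succ.comp (Primrec.fst.comp Primrec.unpair)) (Primrec.const 2)
  exact (this.to_comp.comp computable_ratCode).of_eq fun q => by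
    simp [ratCode, Int.encode_succ_div_two]

theorem Rat.computable_den : Computable fun q : ℚ => q.den := by
  have : Primrec fun k : ℕ => k.unpair.2 := Primrec.snd.comp Primrec.unpair
  exact (this.to_comp.comp computable_ratCode).of_eq fun q => by simp [ratCode]

theorem Rat.computable_nonneg : Computable fun q : ℚ => decide (0 ≤ q) := by
  have : PrimrecPred fun k : ℕ => k.unpair.1 % 2 = 0 := Primrec.eq.comp
    (Primrec.nat_mod.comp (Primrec.fst.comp Primrec.unpair) (Primrec.const 2)) (Primrec.const 0)
  exact (this.decide.to_comp.comp computable_ratCode).of_eq fun q => by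
    simp [ratCode, Int.encode_mod_two]

/-- The quotient of two computable natural-valued functions is a computable rational function. -/
theorem Computable.natCast_div {α : Type*} [Primcodable α] {N D : α → ℕ} (hN : Computable N)
    (hD : Computable D) (h0 : ∀ a, 0 < D a) : Computable fun a => (N a : ℚ) / D a := by
  have hmul : Computable₂ ((· * ·) : ℕ → ℕ → ℕ) := Primrec.nat_mul.to_comp
  have heq : Computable₂ fun a b : ℕ => decide (a = b) := Primrec.eq.decide.to_comp
  have hp : Computable₂ fun (a : α) (r : ℚ) =>
      decide (0 ≤ r) && decide (r.num.natAbs * D a = N a * r.den) :=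
    (Primrec.and.to_comp : Computable₂ and).comp (Rat.computable_nonneg.comp Computable.snd)
      (heq.comp
        (hmul.comp (Rat.computable_natAbs_num.comp Computable.snd) (hD.comp Computable.fst))
        (hmul.comp (hN.comp Computable.fst) (Rat.computable_den.comp Computable.snd)))
  refine Computable.of_graph hp fun a r => ?_
  have hD' : (0 : ℚ) < D a := by exact_mod_cast h0 a
  simp only [Bool.and_eq_true, decide_eq_true_eq]
  have key (hr : 0 ≤ r) : r.num.natAbs * D a = N a * r.den ↔ r = N a / D a := by
    have hn : ((r.num.natAbs : ℕ) : ℚ) = r * r.den := by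
      rw [Rat.mul_den_eq_num, ← Int.cast_natCast, Int.natAbs_of_nonneg (Rat.num_nonneg.2 hr)]
    have hd : (r.den : ℚ) ≠ 0 := by exact_mod_cast r.den_nz
    rw [eq_div_iff hD'.ne', ← @Nat.cast_inj ℚ]
    push_cast
    rw [hn, mul_right_comm, mul_left_inj' hd]
  exact ⟨fun h => (key h.1).1 h.2, fun h =>
    have hr : 0 ≤ r := by rw [h]; positivity
    ⟨hr, (key hr).2 h⟩⟩

theorem Rat.abs_eq_natAbs_div (q : ℚ) : |q| = (q.num.natAbs : ℚ) / q.den := by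
  rw [Rat.abs_def, Rat.divInt_eq_div]; simp

theorem Rat.computable_abs_mul_abs : Computable₂ fun p q : ℚ => |p| * |q| := by
  have hmul : Computable₂ ((· * ·) : ℕ → ℕ → ℕ) := Primrec.nat_mul.to_comp
  refine (Computable.natCast_div
    (hmul.comp (Rat.computable_natAbs_num.comp Computable.fst)
      (Rat.computable_natAbs_num.comp Computable.snd))
    (hmul.comp (Rat.computable_den.comp Computable.fst) (Rat.computable_den.comp Computable.snd))
    fun a => Nat.mul_pos a.1.den_pos a.2.den_pos).of_eq fun a => ?_
  simp only [Rat.abs_eq_natAbs_div]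
  push_cast
  rw [div_mul_div_comm]

theorem Rat.computable_abs_add_abs : Computable₂ fun p q : ℚ => |p| + |q| := by
  have hmul : Computable₂ ((· * ·) : ℕ → ℕ → ℕ) := Primrec.nat_mul.to_comp
  have hadd : Computable₂ ((· + ·) : ℕ → ℕ → ℕ) := Primrec.nat_add.to_comp
  have hn := Rat.computable_natAbs_num
  have hd := Rat.computable_den
  refine (Computable.natCast_div
    (hadd.comp (hmul.comp (hn.comp Computable.fst) (hd.comp Computable.snd))
      (hmul.comp (hd.comp Computable.fst) (hn.comp Computable.snd)))
    (hmul.comp (hd.comp Computable.fst) (hd.comp Computable.snd))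
    fun a => Nat.mul_pos a.1.den_pos a.2.den_pos).of_eq fun a => ?_
  simp only [Rat.abs_eq_natAbs_div]
  have h1 : (a.1.den : ℚ) ≠ 0 := by exact_mod_cast a.1.den_nz
  have h2 : (a.2.den : ℚ) ≠ 0 := by exact_mod_cast a.2.den_nz
  push_cast
  rw [div_add_div _ _ h1 h2]

theorem Rat.computable_abs_le_one : Computable fun q : ℚ => decide (|q| ≤ 1) := by
  have hle : Computable₂ fun a b : ℕ => decide (a ≤ b) := Primrec.nat_le.decide.to_comp
  refine (hle.comp Rat.computable_natAbs_num Rat.computable_den).of_eq fun q => ?_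
  rw [Rat.abs_eq_natAbs_div, decide_eq_decide, div_le_one (by exact_mod_cast q.den_pos)]
  exact Nat.cast_le.symm

theorem Computable.sum_range {α : Type*} [Primcodable α] {h : ℕ → α → ℚ}
    (hh : Computable₂ h) (h0 : ∀ n a, 0 ≤ h n a) :
    Computable₂ fun (k : ℕ) (a : α) => ∑ i ∈ Finset.range k, h i a := by
  have hstep : Computable₂ fun (p : ℕ × α) (r : ℕ × ℚ) => |r.2| + |h r.1 p.2| :=
    Rat.computable_abs_add_abs.comp (Computable.snd.comp Computable.snd)
      (hh.comp (Computable.fst.comp Computable.snd) (Computable.snd.comp Computable.fst))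
  refine (Computable.nat_rec (f := fun p : ℕ × α => p.1) (g := fun _ => (0 : ℚ))
    Computable.fst (Computable.const 0) hstep).of_eq fun p => ?_
  obtain ⟨k, a⟩ := p
  dsimp only
  induction k with
  | zero => simp
  | succ k ih =>
    have hs : 0 ≤ ∑ i ∈ Finset.range k, h i a := Finset.sum_nonneg fun i _ => h0 i a
    rw [Finset.sum_range_succ]
    simp only [ih, abs_of_nonneg hs, abs_of_nonneg (h0 k a)]

theorem qval_sum_range (h : ℕ → ℚ) (h0 : ∀ n, 0 ≤ h n) (k : ℕ) :
    qval (∑ i ∈ Finset.range k, h i) = ∑ i ∈ Finset.range k, qval (h i) := by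
  unfold qval
  rw [Rat.cast_sum, ENNReal.ofReal_sum_of_nonneg fun i _ => by exact_mod_cast h0 i]

theorem qval_le_one_iff (q : ℚ) : qval q ≤ 1 ↔ q ≤ 1 := by
  unfold qval
  rw [ENNReal.ofReal_le_one]
  exact_mod_cast Iff.rfl

/-- Dropping every term at which the partial sums exceed `1` leaves a sum of at most `1`. -/
theorem ENNReal.tsum_ite_sum_range_succ_le_one (u : ℕ → ℝ≥0∞) :
    ∑' n, (if ∑ i ∈ Finset.range (n + 1), u i ≤ 1 then u n else 0) ≤ 1 := by
  refine ENNReal.tsum_le_of_sum_range_le fun k => ?_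
  induction k with
  | zero => simp
  | succ k ih =>
    rw [Finset.sum_range_succ]
    split_ifs with hk
    · refine le_trans ?_ hk
      rw [Finset.sum_range_succ _ k]
      gcongr
      split_ifs <;> simp
    · simpa using ih

section Truncation

variable {α : Type*} [Encodable α]

/-- The values of `g` listed along the codes of its domain, with zeros at the other places. -/
def codeExtend {M : Type*} [Zero M] (g : α → M) (n : ℕ) : M :=
  (decode₂ α n).elim 0 g

theorem codeExtend_encode {M : Type*} [Zero M] (g : α → M) (x : α) :
    codeExtend g (encode x) = g x := by
  simp [codeExtend]

theorem tsum_codeExtend (g : α → ℝ≥0∞) : ∑' n, codeExtend g n = ∑' x, g x := by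
  rw [← (encode_injective (α := α)).tsum_eq]
  · simp only [codeExtend_encode]
  · intro n hn
    by_contra hr
    refine hn ?_
    rw [← decode₂_ne_none_iff, not_not] at hr
    simp [codeExtend, hr]

/-- The function `g`, set to zero from the point on where its partial sums exceed `1`. -/
def truncateSum (g : α → ℚ) (x : α) : ℚ :=
  if ∑ i ∈ Finset.range (encode x + 1), codeExtend g i ≤ 1 then g x else 0

theorem codeExtend_nonneg {g : α → ℚ} (hg : ∀ x, 0 ≤ g x) (n : ℕ) : 0 ≤ codeExtend g n := by
  unfold codeExtend
  cases decode₂ α n <;> simp [hg]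

theorem truncateSum_nonneg {g : α → ℚ} (hg : ∀ x, 0 ≤ g x) (x : α) : 0 ≤ truncateSum g x := by
  unfold truncateSum
  split_ifs <;> simp [hg]

theorem tsum_qval_truncateSum_le_one {g : α → ℚ} (hg : ∀ x, 0 ≤ g x) :
    ∑' x, qval (truncateSum g x) ≤ 1 := by
  refine le_trans ?_ (ENNReal.tsum_ite_sum_range_succ_le_one fun n => qval (codeExtend g n))
  refine le_trans (le_of_eq (tsum_congr fun x => ?_))
    (ENNReal.tsum_comp_le_tsum_of_injective (encode_injective (α := α)) _)
  rw [← qval_sum_range _ (codeExtend_nonneg hg), codeExtend_encode]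
  simp only [qval_le_one_iff, truncateSum]
  split_ifs <;> simp [qval]

theorem tendsto_qval_truncateSum {g : α → ℕ → ℚ} (hg : ∀ x t, 0 ≤ g x t) {f : α → ℝ≥0∞}
    (hf : ∑' x, f x < 1)
    (hgf : ∀ x, Filter.Tendsto (fun t => qval (g x t)) Filter.atTop (nhds (f x))) (x : α) :
    Filter.Tendsto (fun t => qval (truncateSum (fun y => g y t) x)) Filter.atTop
      (nhds (f x)) := by
  have hterm (n : ℕ) : Filter.Tendsto (fun t => qval (codeExtend (fun y => g y t) n))
      Filter.atTop (nhds (codeExtend f n)) := by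
    unfold codeExtend
    cases decode₂ α n with
    | none => simp [qval]
    | some y => exact hgf y
  have hsum := tendsto_finsetSum (Finset.range (encode x + 1)) fun n _ => hterm n
  have hlt : ∑ n ∈ Finset.range (encode x + 1), codeExtend f n < 1 :=
    ((ENNReal.sum_le_tsum _).trans_eq (tsum_codeExtend f)).trans_lt hf
  refine (hgf x).congr' ?_
  filter_upwards [hsum.eventually_lt_const hlt] with t ht
  rw [← qval_sum_range _ (codeExtend_nonneg fun y => hg y t)] at ht
  rw [truncateSum, if_pos ((qval_le_one_iff _).1 ht.le)]

end Truncation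

theorem computable_truncateSum {α : Type*} [Primcodable α] {g : α → ℕ → ℚ}
    (hc : Computable₂ g) (hg : ∀ x t, 0 ≤ g x t) :
    Computable₂ fun (x : α) (t : ℕ) => truncateSum (fun y => g y t) x := by
  have hext : Computable₂ fun n t : ℕ => codeExtend (fun y => g y t) n := by
    have hd : Computable fun p : ℕ × ℕ => decode₂ α p.1 :=
      Primrec.decode₂.to_comp.comp Computable.fst
    have hb : Computable₂ fun (p : ℕ × ℕ) (y : α) => g y p.2 :=
      hc.comp Computable.snd (Computable.snd.comp Computable.fst)
    refine (Computable.option_casesOn hd (Computable.const 0) hb).of_eq fun p => ?_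
    dsimp only [codeExtend]
    cases decode₂ α p.1 <;> rfl
  have hsum := Computable.sum_range hext fun n t => codeExtend_nonneg (fun y => hg y t) n
  have hle : Computable fun p : α × ℕ => decide
      (|∑ i ∈ Finset.range (encode p.1 + 1), codeExtend (fun y => g y p.2) i| ≤ 1) :=
    Rat.computable_abs_le_one.comp
      (hsum.comp (Computable.succ.comp (Computable.encode.comp Computable.fst)) Computable.snd)
  refine (Computable.cond hle hc (Computable.const 0)).of_eq fun p => ?_
  dsimp only [truncateSum]
  rw [abs_of_nonneg
    (Finset.sum_nonneg fun i _ => codeExtend_nonneg (fun y => hg y p.2) i), Bool.cond_decide]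

/-- A limit of computable functions with sum at most `1` is dominated by the limit inferior of a
universal conditional semimeasure. -/
theorem IsUniversalCondSemimeasure.le_liminf_of_tendsto {mc : List Bool → ℕ → ℝ≥0∞}
    (hmc : IsUniversalCondSemimeasure mc) {f : List Bool → ℝ≥0∞} (hf : ∑' x, f x ≤ 1)
    {g : List Bool → ℕ → ℚ} (hc : Computable₂ g) (hg : ∀ x t, 0 ≤ g x t)
    (hgf : ∀ x, Filter.Tendsto (fun t => qval (g x t)) Filter.atTop (nhds (f x))) :
    ∃ c : ℝ≥0, 0 < c ∧
      ∀ x, f x ≤ c * Filter.liminf (fun t : ℕ => mc x t) Filter.atTop := by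
  set g' : List Bool → ℕ → ℚ := fun x t => |g x t| * |(1 / 2 : ℚ)| with hg'_def
  have hg' (x t) : 0 ≤ g' x t := by positivity
  have hc' : Computable₂ g' := Rat.computable_abs_mul_abs.comp hc (Computable.const _)
  have hval (x t) : qval (g' x t) = qval (g x t) * 2⁻¹ := by
    simp only [hg'_def, qval, abs_of_nonneg (hg x t)]
    rw [abs_of_nonneg (by norm_num)]
    push_cast
    rw [ENNReal.ofReal_mul (by exact_mod_cast hg x t), one_div,
      ENNReal.ofReal_inv_of_pos two_pos, ENNReal.ofReal_ofNat]
  have hgf' (x) : Filter.Tendsto (fun t => qval (g' x t)) Filter.atTop (nhds (f x * 2⁻¹)) := by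
    simp only [hval]
    exact ENNReal.Tendsto.mul_const (hgf x) (Or.inr (by simp))
  have hf' : ∑' x, f x * 2⁻¹ < 1 := by
    rw [ENNReal.tsum_mul_right]
    refine (mul_le_mul_left hf _).trans_lt ?_
    rw [one_mul]
    exact ENNReal.one_half_lt_one
  obtain ⟨c, hc0, hle⟩ := hmc.2.2
    (fun x t => qval (truncateSum (fun y => g' y t) x))
    (fun t => tsum_qval_truncateSum_le_one fun y => hg' y t)
    ⟨fun _ x t => truncateSum (fun y => g' y t) x,
      (computable_truncateSum hc' hg').comp (Computable.fst.comp Computable.snd)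
        (Computable.snd.comp Computable.snd),
      fun _ x t => truncateSum_nonneg (fun y => hg' y t) x,
      fun _ _ => monotone_const, fun _ _ => by simp⟩
  refine ⟨2 * c, by positivity, fun x => ?_⟩
  have hlim : f x * 2⁻¹ ≤ c * Filter.liminf (fun t : ℕ => mc x t) Filter.atTop := by
    rw [← (tendsto_qval_truncateSum hg' hf' hgf' x).liminf_eq,
      ← ENNReal.liminf_const_mul_of_ne_top ENNReal.coe_ne_top]
    exact Filter.liminf_le_liminf (Filter.Eventually.of_forall fun t => hle x t)
  calc f x = 2 * (f x * 2⁻¹) := by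
        rw [mul_left_comm, ENNReal.mul_inv_cancel two_ne_zero ENNReal.ofNat_ne_top, mul_one]
    _ ≤ 2 * (c * Filter.liminf (fun t : ℕ => mc x t) Filter.atTop) := by gcongr
    _ = _ := by push_cast; rw [mul_assoc]

/-- Approximations of `e` from above and of `m` from below multiply to an approximation of
`e * m` in the limit, with the value `∞` of an approximation replaced by `0`. -/
theorem tendsto_qval_approx_mul {e m : List Bool → ℝ≥0∞} {es : List Bool → ℕ → Option ℚ}
    {ms : List Bool → ℕ → ℚ} (he : IsApproxFromAbove e es) (hm : IsApproxFromBelow m ms)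
    {x : List Bool} (hx : e x * m x ≠ ⊤) (hmx : m x ≠ ⊤) :
    Filter.Tendsto (fun t => qval ((es x t).elim 0 fun a => |a| * |ms x t|)) Filter.atTop
      (nhds (e x * m x)) := by
  obtain ⟨-, he0, hea, hei⟩ := he
  obtain ⟨-, hm0, hmm, hms⟩ := hm
  have hqm : Filter.Tendsto (fun t => qval (ms x t)) Filter.atTop (nhds (m x)) := by
    rw [hms]
    exact tendsto_atTop_iSup fun s t hst =>
      ENNReal.ofReal_le_ofReal (by exact_mod_cast hmm x hst)
  have hqe : Filter.Tendsto (fun t => qtval (es x t)) Filter.atTop (nhds (e x)) := by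
    rw [hei]
    exact tendsto_atTop_iInf (hea x)
  by_cases hex : e x = ⊤
  · have hnone (t) : es x t = none := by
      have : qtval (es x t) = ⊤ := by
        rw [← top_le_iff, ← hex, hei]
        exact iInf_le _ t
      cases h : es x t with
      | none => rfl
      | some a => simp [h, qtval] at this
    have hm' : m x = 0 := by
      by_contra h
      exact hx (by rw [hex, ENNReal.top_mul h])
    simp [hnone, hm', qval]
  · refine (ENNReal.Tendsto.mul hqe (Or.inr hmx) hqm (Or.inr hex)).congr' ?_
    filter_upwards [hqe.eventually_lt_const (lt_top_iff_ne_top.2 hex)] with t ht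
    cases h : es x t with
    | none => simp [h, qtval] at ht
    | some a =>
      have ha : 0 ≤ a := he0 x t a h
      simp only [qtval, qval, Option.elim_some, abs_of_nonneg ha, abs_of_nonneg (hm0 x t)]
      rw [Rat.cast_mul, ENNReal.ofReal_mul (by exact_mod_cast ha)]

/-- Corollary 1: for every upper semicomputable sumtest `e` for a universal semimeasure `m`,
`e(x) · m(x) ≤ c · liminf_t m(x|t)` for some constant `c > 0`
(i.e. `log e(x) ≤ K(x) − K^{∅'}(x) + O(1)`). -/
theorem log_sumtest_le_mutual_information_with_halting_problem
    (m : List Bool → ℝ≥0∞) (hm : IsUniversalSemimeasure m)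
    (mc : List Bool → ℕ → ℝ≥0∞) (hmc : IsUniversalCondSemimeasure mc)
    (e : List Bool → ℝ≥0∞) (he : UpperSemicomputable e) (hse : IsSumtest m e) :
    ∃ c : ℝ≥0, 0 < c ∧
      ∀ x, e x * m x ≤ c * Filter.liminf (fun t : ℕ => mc x t) Filter.atTop := by
  obtain ⟨hsum, ⟨ms, hms⟩, -⟩ := hm
  obtain ⟨es, hes⟩ := he
  have hse' : ∑' x, e x * m x ≤ 1 := by simpa only [IsSumtest, mul_comm] using hse
  have hfin {f : List Bool → ℝ≥0∞} (hf : ∑' x, f x ≤ 1) (x) : f x ≠ ⊤ :=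
    ne_top_of_le_ne_top ENNReal.one_ne_top ((ENNReal.le_tsum x).trans hf)
  have hb : Computable₂ fun (p : List Bool × ℕ) (a : ℚ) => |a| * |ms p.1 p.2| :=
    Rat.computable_abs_mul_abs.comp Computable.snd (hms.1.comp Computable.fst)
  refine hmc.le_liminf_of_tendsto hse'
    (g := fun x t => (es x t).elim 0 fun a => |a| * |ms x t|) ?_ (fun x t => ?_)
    fun x => tendsto_qval_approx_mul hes hms (hfin hse' x) (hfin hsum x)
  · refine (Computable.option_casesOn hes.1 (Computable.const 0) hb).of_eq fun p => ?_
    dsimp only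
    cases es p.1 p.2 <;> rfl
  · cases es x t with
    | none => exact le_rfl
    | some a => exact mul_nonneg (abs_nonneg _) (abs_nonneg _)
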